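/- (Extra-Gradient on the Continuous Extension convergence.) Let (V, 𝓘) be a matroid on a finite set V, and let f : ℝ^d × 2^V → [0, ∞) be such that f(·, S) is convex and differentiable for every S ⊆ V and f(x, ·) is monotone and submodular for every x. Let F(x, y) = ∑_{S ⊆ V} f(x, S) ∏_{i ∈ S} y_i ∏_{i ∉ S} (1 − y_i) and K = conv{ 1_S : S ∈ 𝓘 } ⊆ [0,1]^V. Let X ⊆ ℝ^d be nonempty, closed, and convex, x₁ ∈ X, y₁ ∈ K, and H > 0 with ‖x − x₁‖² ≤ H for all x ∈ X and ‖y − y₁‖² ≤ H for all y ∈ K. Assume F is differentiable in (x, y) and the map (x, y) ↦ (∇ₓ F(x, y), ∇_y F(x, y)) is L-Lipschitz on X × K, and let γ > 0 satisfy 2γL ≤ 1. For a positive integer T, suppose iterates satisfy for all 1 ≤ t ≤ T: x̂_t = π_X(x_t − γ ∇ₓ F(x_t, y_t)); ŷ_t = π_K(y_t + γ ∇_y F(x_t, y_t)); x_{t+1} = π_X(x_t − γ ∇ₓ F(x̂_t, ŷ_t)); y_{t+1} = π_K(y_t + γ ∇_y F(x̂_t, ŷ_t)). Then, with x̄ =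 (1/T) ∑_{t=1}^T x̂_t: (1/2) · max_{S ∈ 𝓘} f(x̄, S) ≤ min_{x ∈ X} max_{S ∈ 𝓘} f(x, S) + 3H/(2γT). -/

import Mathlib

open scoped RealInnerProductSpace

/-- The multilinear extension of a set function `g : 2^V → ℝ` on
`EuclideanSpace ℝ V`:
`F(y) = ∑_{S ⊆ V} g(S) ∏_{i ∈ S} y_i ∏_{i ∉ S} (1 − y_i)`. -/
noncomputable def multilinearExt {V : Type} [Fintype V] [DecidableEq V]
    (g : Finset V → ℝ) (y : EuclideanSpace ℝ V) : ℝ :=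
  ∑ S : Finset V, g S * ((∏ i ∈ S, y i) * ∏ i ∈ Sᶜ, (1 - y i))

section MultilinearExtension

variable {V : Type} [DecidableEq V]

/-- The indicator vector of a finite set. -/
noncomputable def indicatorVec (S : Finset V) : EuclideanSpace ℝ V :=
  WithLp.toLp 2 fun i => if i ∈ S then (1 : ℝ) else 0

lemma indicatorVec_apply (S : Finset V) (i : V) :
    indicatorVec S i = if i ∈ S then (1 : ℝ) else 0 := rfl

/-- The marginal difference of a set function in direction `i`. -/
def marginalDiff (i : V) (g : Finset V → ℝ) (R : Finset V) : ℝ :=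
  g (insert i R) - g (R.erase i)

variable {g : Finset V → ℝ}

lemma submodular_union_sub_le
    (hsub : ∀ S T : Finset V, g (S ∩ T) + g (S ∪ T) ≤ g S + g T) (R S : Finset V) :
    g (R ∪ S) - g R ≤ ∑ i ∈ S, (g (insert i R) - g R) := by
  induction S using Finset.induction_on with
  | empty => simp
  | insert a S ha ih =>
    rw [Finset.sum_insert ha]
    by_cases haR : a ∈ R
    · have h1 : R ∪ insert a S = R ∪ S := by
        rw [Finset.union_insert, Finset.insert_eq_of_mem (Finset.mem_union_left _ haR)]
      rw [h1, Finset.insert_eq_of_mem haR]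
      linarith
    · have h := hsub (insert a R) (R ∪ S)
      have h1 : insert a R ∩ (R ∪ S) = R := by
        ext j
        by_cases hj : j = a
        · subst hj; simp [haR, ha]
        · simp only [Finset.mem_inter, Finset.mem_insert, Finset.mem_union]; tauto
      have h2 : insert a R ∪ (R ∪ S) = R ∪ insert a S := by
        ext j
        simp only [Finset.mem_insert, Finset.mem_union]; tauto
      rw [h1, h2] at h
      linarith

lemma submodular_sdiff_sub_le
    (hsub : ∀ S T : Finset V, g (S ∩ T) + g (S ∪ T) ≤ g S + g T) (R S : Finset V) :
    g (R \ S) - g R ≤ ∑ i ∈ S, (g (R.erase i) - g R) := by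
  induction S using Finset.induction_on with
  | empty => simp
  | insert a S ha ih =>
    rw [Finset.sum_insert ha]
    by_cases haR : a ∈ R
    · have h := hsub (R.erase a) (R \ S)
      have h1 : R.erase a ∩ (R \ S) = R \ insert a S := by
        ext j
        simp only [Finset.mem_inter, Finset.mem_insert, Finset.mem_sdiff, Finset.mem_erase]; tauto
      have h2 : R.erase a ∪ (R \ S) = R := by
        ext j
        by_cases hj : j = a
        · subst hj; simp [haR, ha]
        · simp only [Finset.mem_union, Finset.mem_sdiff, Finset.mem_erase]; tauto
      rw [h1, h2] at h
      linarith
    · have h1 : R \ insert a S = R \ S := by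
        rw [Finset.sdiff_insert, Finset.erase_eq_of_notMem]
        simp [haR]
      rw [h1, Finset.erase_eq_of_notMem haR]
      linarith

lemma marginalDiff_marginalDiff_nonpos 
    (hsub : ∀ S T : Finset V, g (S ∩ T) + g (S ∪ T) ≤ g S + g T) {i j : V} (hij : i ≠ j)
    (R : Finset V) : marginalDiff j (marginalDiff i g) R ≤ 0 := by
  have h := hsub (insert i ((R.erase j).erase i)) ((insert j R).erase i)
  have h1 : insert i ((R.erase j).erase i) ∩ (insert j R).erase i = (R.erase j).erase i := by
    ext k
    simp only [Finset.mem_inter, Finset.mem_insert, Finset.mem_erase]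
    tauto
  have h2 : insert i ((R.erase j).erase i) ∪ (insert j R).erase i = insert i (insert j R) := by
    ext k
    by_cases hk : k = i <;> by_cases hk' : k = j <;>
      simp [hk, hk', hij, hij.symm]
  have h3 : insert i ((R.erase j).erase i) = insert i (R.erase j) := by
    ext k
    by_cases hk : k = i <;> simp [hk]
  rw [h1, h2, h3] at h
  simp only [marginalDiff]
  linarith

lemma indicatorVec_insert_sub {S : Finset V} {i : V} (hi : i ∉ S) :
    indicatorVec (insert i S) - indicatorVec S = EuclideanSpace.single i (1 : ℝ) := by
  ext k
  by_cases hk : k = i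
  · subst hk; simp [indicatorVec_apply, hi]
  · simp [indicatorVec_apply, hk]

lemma indicatorVec_exchange_sub {S : Finset V} {i j : V} (hi : i ∈ S) (hj : j ∉ S) :
    indicatorVec (insert j (S.erase i)) - indicatorVec S =
      EuclideanSpace.single j (1 : ℝ) - EuclideanSpace.single i (1 : ℝ) := by
  have hji : j ∉ S.erase i := fun h => hj (Finset.mem_of_mem_erase h)
  rw [← indicatorVec_insert_sub hji, ← indicatorVec_insert_sub (Finset.notMem_erase i S),
    Finset.insert_erase hi]
  abel

lemma exists_double_exchange {𝓘 : Finset (Finset V)} (h𝓘 : 𝓘.Nonempty)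
    (hdown : ∀ A B : Finset V, A ⊆ B → B ∈ 𝓘 → A ∈ 𝓘)
    (hexch : ∀ A B : Finset V, A ∈ 𝓘 → B ∈ 𝓘 → A.card < B.card →
      ∃ e ∈ B \ A, insert e A ∈ 𝓘)
    {A B : Finset V} (hA : A ∈ 𝓘) (hB : B ∈ 𝓘) {i : V} (hiA : i ∈ A) (hiB : i ∉ B) :
    insert i B ∈ 𝓘 ∨
      ∃ j ∈ B, j ∉ A ∧ insert j (A.erase i) ∈ 𝓘 ∧ insert i (B.erase j) ∈ 𝓘 := by
  obtain ⟨S₀, hS₀⟩ := h𝓘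
  obtain ⟨M, hE, hM⟩ : ∃ M : Matroid V, M.E = Set.univ ∧
      ∀ S : Finset V, M.Indep (S : Set V) ↔ S ∈ 𝓘 :=
    ⟨(IndepMatroid.ofFinset Set.univ (fun S => S ∈ 𝓘)
      (hdown _ _ (Finset.empty_subset _) hS₀) (fun I J hJ hIJ => hdown I J hIJ hJ)
      (fun I J hI hJ hIJ => by
        obtain ⟨e, he, h⟩ := hexch I J hI hJ hIJ
        exact ⟨e, (Finset.mem_sdiff.1 he).1, (Finset.mem_sdiff.1 he).2, h⟩)
      (fun _ _ => Set.subset_univ _)).matroid, rfl, fun S => by simp⟩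
  have hcl : ∀ (S : Finset V) (e : V), S ∈ 𝓘 → insert e S ∉ 𝓘 → e ∈ M.closure (S : Set V) := by
    intro S e hS he
    by_contra hcon
    refine he ((hM _).1 ?_)
    rw [Finset.coe_insert, ((hM S).2 hS).insert_indep_iff]
    exact Or.inl ⟨by simp [hE], hcon⟩
  by_contra! hcon
  obtain ⟨hins, hex⟩ := hcon
  have hi := hcl B i hB hins
  have hcirc := ((hM B).2 hB).fundCircuit_isCircuit hi (by simpa using hiB)
  have hAi : A.erase i ∈ 𝓘 := hdown _ _ (Finset.erase_subset _ _) hA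
  have hsub : M.fundCircuit i B \ {i} ⊆ M.closure ((A.erase i : Finset V) : Set V) := by
    rintro j ⟨hjC, hji⟩
    have hji' : j ≠ i := hji
    have hjB : j ∈ B := by
      simpa [hji'] using M.fundCircuit_subset_insert i B hjC
    by_cases hjA : j ∈ A
    · exact M.subset_closure _ (by simp [hE]) (by simpa [hji'] using hjA)
    · refine hcl _ _ hAi fun hj => hex j hjB hjA hj ((hM _).1 ?_)
      have := (((hM B).2 hB).mem_fundCircuit_iff hi (by simpa using hiB)).1 hjC
      convert this using 1
      ext k
      by_cases hk : k = i
      · simp [hk, hji'.symm]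
      · simp [hk, and_comm]
  have hmem : i ∈ M.closure (M.fundCircuit i B \ {i}) :=
    hcirc.mem_closure_sdiff_singleton_of_mem (M.mem_fundCircuit i B)
  have hmem' := M.closure_subset_closure_of_subset_closure hsub hmem
  refine ((hM A).2 hA).notMem_closure_sdiff_of_mem (by simpa using hiA) ?_
  simpa using hmem'

variable [Fintype V]

lemma multilinearExt_split (g : Finset V → ℝ) (y : EuclideanSpace ℝ V) (i : V) :
    multilinearExt g y = ∑ R ∈ (Finset.univ.erase i).powerset,
      ((∏ j ∈ R, y j) * ∏ j ∈ (insert i R)ᶜ, (1 - y j)) *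
        (y i * g (insert i R) + (1 - y i) * g R) := by
  have huniv : (Finset.univ : Finset (Finset V)) = (insert i (Finset.univ.erase i)).powerset := by
    rw [Finset.insert_erase (Finset.mem_univ i), Finset.powerset_univ]
  rw [multilinearExt, huniv, Finset.sum_powerset_insert (Finset.notMem_erase i _),
    ← Finset.sum_add_distrib]
  refine Finset.sum_congr rfl fun R hR => ?_
  have hi : i ∉ R := fun h => Finset.notMem_erase i _ (Finset.mem_powerset.1 hR h)
  have hc : Rᶜ = insert i (insert i R)ᶜ := by
    ext j
    by_cases hj : j = i <;> simp [hj, hi]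
  rw [Finset.prod_insert hi, hc, Finset.prod_insert (by simp)]
  ring

lemma multilinearExt_add_single (g : Finset V → ℝ) (y : EuclideanSpace ℝ V) (i : V) (s : ℝ) :
    multilinearExt g (y + EuclideanSpace.single i s) =
      multilinearExt g y + s * multilinearExt (marginalDiff i g) y := by
  rw [multilinearExt_split g _ i, multilinearExt_split g y i,
    multilinearExt_split (marginalDiff i g) y i, Finset.mul_sum, ← Finset.sum_add_distrib]
  refine Finset.sum_congr rfl fun R hR => ?_
  have hi : i ∉ R := fun h => Finset.notMem_erase i _ (Finset.mem_powerset.1 hR h)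
  have h1 : ∏ j ∈ R, (y + EuclideanSpace.single i s) j = ∏ j ∈ R, y j := by
    refine Finset.prod_congr rfl fun j hj => ?_
    have hne : j ≠ i := fun h => hi (h ▸ hj)
    simp [hne]
  have h2 : ∏ j ∈ (insert i R)ᶜ, (1 - (y + EuclideanSpace.single i s) j) =
      ∏ j ∈ (insert i R)ᶜ, (1 - y j) := by
    refine Finset.prod_congr rfl fun j hj => ?_
    have hne : j ≠ i := fun h => by simp [h] at hj
    simp [hne]
  rw [h1, h2]
  simp only [marginalDiff, Finset.insert_idem, Finset.erase_insert hi,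
    Finset.erase_eq_of_notMem hi]
  simp
  ring

lemma multilinearExt_add (g h : Finset V → ℝ) (y : EuclideanSpace ℝ V) :
    multilinearExt (fun R => g R + h R) y = multilinearExt g y + multilinearExt h y := by
  simp only [multilinearExt, add_mul, Finset.sum_add_distrib]

lemma multilinearExt_const_mul (c : ℝ) (g : Finset V → ℝ) (y : EuclideanSpace ℝ V) :
    multilinearExt (fun R => c * g R) y = c * multilinearExt g y := by
  simp only [multilinearExt, Finset.mul_sum, mul_assoc]

lemma multilinearExt_sum {ι : Type*} (s : Finset ι) (g : ι → Finset V → ℝ)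
    (y : EuclideanSpace ℝ V) :
    multilinearExt (fun R => ∑ i ∈ s, g i R) y = ∑ i ∈ s, multilinearExt (g i) y := by
  simp only [multilinearExt, Finset.sum_mul]
  exact Finset.sum_comm

lemma multilinearExt_const (c : ℝ) (y : EuclideanSpace ℝ V) :
    multilinearExt (fun _ => c) y = c := by
  rw [multilinearExt, ← Finset.mul_sum, ← Fintype.prod_add]
  simp

lemma multilinearExt_mono {g h : Finset V → ℝ} (hgh : ∀ R, g R ≤ h R)
    {y : EuclideanSpace ℝ V} (hy : ∀ i, 0 ≤ y i ∧ y i ≤ 1) :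
    multilinearExt g y ≤ multilinearExt h y := by
  refine Finset.sum_le_sum fun R _ => mul_le_mul_of_nonneg_right (hgh R) ?_
  exact mul_nonneg (Finset.prod_nonneg fun i _ => (hy i).1)
    (Finset.prod_nonneg fun i _ => sub_nonneg.2 (hy i).2)

lemma multilinearExt_indicatorVec (g : Finset V → ℝ) (S : Finset V) :
    multilinearExt g (indicatorVec S) = g S := by
  rw [multilinearExt, Finset.sum_eq_single S]
  · rw [Finset.prod_eq_one, Finset.prod_eq_one]
    · simp
    · intro i hi
      simp [indicatorVec_apply, Finset.mem_compl.1 hi]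
    · intro i hi
      simp [indicatorVec_apply, hi]
  · intro R _ hRS
    by_cases h : R ⊆ S
    · obtain ⟨i, hiS, hiR⟩ := Finset.exists_of_ssubset (h.ssubset_of_ne hRS)
      rw [Finset.prod_eq_zero (i := i) (s := Rᶜ) (by simpa using hiR)
        (by simp [indicatorVec_apply, hiS])]
      simp
    · obtain ⟨i, hiR, hiS⟩ := Finset.not_subset.1 h
      rw [Finset.prod_eq_zero (i := i) (s := R) hiR (by simp [indicatorVec_apply, hiS])]
      simp
  · simp

lemma multilinearExt_insert_sub (g : Finset V → ℝ) (y : EuclideanSpace ℝ V) (i : V) :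
    multilinearExt (fun R => g (insert i R) - g R) y =
      (1 - y i) * multilinearExt (marginalDiff i g) y := by
  rw [multilinearExt_split _ y i, multilinearExt_split (marginalDiff i g) y i, Finset.mul_sum]
  refine Finset.sum_congr rfl fun R hR => ?_
  have hi : i ∉ R := fun h => Finset.notMem_erase i _ (Finset.mem_powerset.1 hR h)
  simp only [marginalDiff, Finset.insert_idem, Finset.erase_insert hi,
    Finset.erase_eq_of_notMem hi]
  ring

lemma multilinearExt_erase_sub (g : Finset V → ℝ) (y : EuclideanSpace ℝ V) (i : V) :
    multilinearExt (fun R => g (R.erase i) - g R) y =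
      -(y i) * multilinearExt (marginalDiff i g) y := by
  rw [multilinearExt_split _ y i, multilinearExt_split (marginalDiff i g) y i, Finset.mul_sum]
  refine Finset.sum_congr rfl fun R hR => ?_
  have hi : i ∉ R := fun h => Finset.notMem_erase i _ (Finset.mem_powerset.1 hR h)
  simp only [marginalDiff, Finset.insert_idem, Finset.erase_insert hi,
    Finset.erase_eq_of_notMem hi]
  ring

lemma continuous_multilinearExt (g : Finset V → ℝ) :
    Continuous (multilinearExt g : EuclideanSpace ℝ V → ℝ) := by
  unfold multilinearExt
  fun_prop

lemma gradient_multilinearExt_apply {g : Finset V → ℝ} {y G : EuclideanSpace ℝ V}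
    (hG : HasGradientAt (fun w => multilinearExt g w) G y) (i : V) :
    G i = multilinearExt (marginalDiff i g) y := by
  have hG' : HasFDerivAt (fun w => multilinearExt g w) (InnerProductSpace.toDual ℝ _ G) y := hG
  have hline : HasDerivAt (fun s : ℝ => y + s • EuclideanSpace.single i (1 : ℝ))
      (EuclideanSpace.single i (1 : ℝ)) 0 := by
    simpa using ((hasDerivAt_id (0 : ℝ)).smul_const (EuclideanSpace.single i (1 : ℝ))).const_add y
  have h1 := HasFDerivAt.comp_hasDerivAt (x := (0 : ℝ))
    (f := fun s : ℝ => y + s • EuclideanSpace.single i (1 : ℝ)) (by simpa using hG') hline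
  have h2 : HasDerivAt (fun s : ℝ => multilinearExt g y + s * multilinearExt (marginalDiff i g) y)
      (multilinearExt (marginalDiff i g) y) 0 := by
    simpa using ((hasDerivAt_id (0 : ℝ)).mul_const
      (multilinearExt (marginalDiff i g) y)).const_add (multilinearExt g y)
  have heq : (fun w => multilinearExt g w) ∘
      (fun s : ℝ => y + s • EuclideanSpace.single i (1 : ℝ)) =
      fun s : ℝ => multilinearExt g y + s * multilinearExt (marginalDiff i g) y := by
    funext s
    simp only [Function.comp]
    rw [← multilinearExt_add_single]
    congr 2
    ext j
    simp
  rw [heq] at h1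
  have := h1.unique h2
  rw [← this]
  simp [InnerProductSpace.toDual_apply_apply, EuclideanSpace.inner_single_right]

/-- For monotone submodular `g ≥ 0`, the gradient `G` of the multilinear extension at `y`
satisfies `g(S) - 2 F(y) ≤ ⟨G, 1_S - y⟩`. -/
lemma sub_two_mul_multilinearExt_le_inner
    (hnonneg : ∀ S, 0 ≤ g S) (hmono : ∀ S T : Finset V, S ⊆ T → g S ≤ g T)
    (hsub : ∀ S T : Finset V, g (S ∩ T) + g (S ∪ T) ≤ g S + g T)
    {y G : EuclideanSpace ℝ V} (hy : ∀ i, 0 ≤ y i ∧ y i ≤ 1)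
    (hG : HasGradientAt (fun w => multilinearExt g w) G y) (S : Finset V) :
    g S - 2 * multilinearExt g y ≤ ⟪G, indicatorVec S - y⟫ := by
  have hinner : ⟪G, indicatorVec S - y⟫ =
      multilinearExt (fun R => ∑ i ∈ S, (g (insert i R) - g R) +
        ∑ i ∈ Sᶜ, (g (R.erase i) - g R)) y := by
    rw [multilinearExt_add, multilinearExt_sum, multilinearExt_sum, PiLp.inner_apply,
      ← Finset.sum_add_sum_compl S]
    congr 1 <;> refine Finset.sum_congr rfl fun i hi => ?_
    · rw [multilinearExt_insert_sub, ← gradient_multilinearExt_apply hG i]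
      simp [indicatorVec_apply, hi]
    · rw [multilinearExt_erase_sub, ← gradient_multilinearExt_apply hG i]
      simp [indicatorVec_apply, Finset.mem_compl.1 hi]
  have hle : multilinearExt (fun R => g S + (-2) * g R) y ≤
      multilinearExt (fun R => ∑ i ∈ S, (g (insert i R) - g R) +
        ∑ i ∈ Sᶜ, (g (R.erase i) - g R)) y := by
    refine multilinearExt_mono (fun R => ?_) hy
    have h1 := submodular_union_sub_le hsub R S
    have h2 := submodular_sdiff_sub_le hsub R Sᶜ
    have h3 := hmono S (R ∪ S) Finset.subset_union_right
    have h4 := hnonneg (R \ Sᶜ)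
    linarith
  rw [hinner]
  refine le_trans (le_of_eq ?_) hle
  rw [multilinearExt_add, multilinearExt_const, multilinearExt_const_mul]
  ring

end MultilinearExtension

section MatroidPolytope

variable {V : Type} [Fintype V] [DecidableEq V] {𝓘 : Finset (Finset V)}

lemma mem_convexHull_indicatorVec_iff (y : EuclideanSpace ℝ V) :
    y ∈ convexHull ℝ (indicatorVec '' (𝓘 : Set (Finset V))) ↔
      ∃ w : Finset V → ℝ, (∀ S ∈ 𝓘, 0 ≤ w S) ∧ ∑ S ∈ 𝓘, w S = 1 ∧
        ∑ S ∈ 𝓘, w S • indicatorVec S = y := by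
  classical
  have hinj : Function.Injective (indicatorVec : Finset V → EuclideanSpace ℝ V) := by
    intro S R h
    ext i
    have h' : indicatorVec S i = indicatorVec R i := by rw [h]
    rw [indicatorVec_apply, indicatorVec_apply] at h'
    by_cases h1 : i ∈ S <;> by_cases h2 : i ∈ R <;> simp [h1, h2] at h' ⊢
  constructor
  · intro hy
    rw [← Finset.coe_image, Finset.mem_convexHull'] at hy
    obtain ⟨w, hw0, hw1, hwy⟩ := hy
    rw [Finset.sum_image hinj.injOn] at hw1 hwy
    exact ⟨fun S => w (indicatorVec S),
      fun S hS => hw0 _ (Finset.mem_image_of_mem _ hS), hw1, hwy⟩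
  · rintro ⟨w, hw0, hw1, rfl⟩
    exact (convex_convexHull ℝ _).sum_mem hw0 hw1 fun S hS =>
      subset_convexHull ℝ _ (Set.mem_image_of_mem _ hS)

lemma mem_Icc_of_mem_convexHull_indicatorVec {y : EuclideanSpace ℝ V}
    (hy : y ∈ convexHull ℝ (indicatorVec '' (𝓘 : Set (Finset V)))) (i : V) :
    0 ≤ y i ∧ y i ≤ 1 := by
  obtain ⟨w, hw0, hw1, rfl⟩ := (mem_convexHull_indicatorVec_iff y).1 hy
  have happ : (∑ S ∈ 𝓘, w S • indicatorVec S) i = ∑ S ∈ 𝓘, w S * indicatorVec S i := by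
    simp
  rw [happ]
  constructor
  · refine Finset.sum_nonneg fun S hS => mul_nonneg (hw0 S hS) ?_
    rw [indicatorVec_apply]; split_ifs <;> norm_num
  · rw [← hw1]
    refine Finset.sum_le_sum fun S hS => mul_le_of_le_one_right (hw0 S hS) ?_
    rw [indicatorVec_apply]; split_ifs <;> norm_num

lemma add_smul_sub_mem_convexHull_indicatorVec {w : Finset V → ℝ}
    (hw0 : ∀ S ∈ 𝓘, 0 ≤ w S) (hw1 : ∑ S ∈ 𝓘, w S = 1) {A B : Finset V} (hA : A ∈ 𝓘)
    (hB : B ∈ 𝓘) {ε : ℝ} (hε : 0 ≤ ε) (hεA : ε ≤ w A) :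
    ∑ S ∈ 𝓘, w S • indicatorVec S + ε • (indicatorVec B - indicatorVec A) ∈
      convexHull ℝ (indicatorVec '' (𝓘 : Set (Finset V))) := by
  rw [mem_convexHull_indicatorVec_iff]
  refine ⟨fun S => w S + (if S = B then ε else 0) - (if S = A then ε else 0), ?_, ?_, ?_⟩
  · intro S hS
    have := hw0 S hS
    by_cases h1 : S = A
    · subst h1
      simp only [if_true]
      split_ifs <;> linarith
    · simp only [h1, if_false]
      split_ifs <;> linarith
  · simp [Finset.sum_add_distrib, Finset.sum_sub_distrib, hA, hB, hw1]
  · simp [add_smul, sub_smul, ite_smul, Finset.sum_add_distrib, Finset.sum_sub_distrib, hA, hB,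
      smul_sub, add_sub_assoc]

lemma multilinearExt_add_smul_single_sub_single (g : Finset V → ℝ) (y : EuclideanSpace ℝ V)
    (i j : V) (s : ℝ) :
    multilinearExt g (y + s • (EuclideanSpace.single i (1 : ℝ) - EuclideanSpace.single j (1 : ℝ))) =
      multilinearExt g y +
        s * (multilinearExt (marginalDiff i g) y - multilinearExt (marginalDiff j g) y) +
        s ^ 2 * -multilinearExt (marginalDiff j (marginalDiff i g)) y := by
  have h : y + s • (EuclideanSpace.single i (1 : ℝ) - EuclideanSpace.single j (1 : ℝ)) =
      (y + EuclideanSpace.single j (-s)) + EuclideanSpace.single i s := by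
    ext k
    simp
    split_ifs <;> ring
  rw [h, multilinearExt_add_single, multilinearExt_add_single, multilinearExt_add_single]
  ring

/-- Over the independence polytope of a matroid, the multilinear extension of a submodular
function is bounded by its value at an independent set. -/
lemma exists_multilinearExt_le (h𝓘 : 𝓘.Nonempty)
    (hdown : ∀ A B : Finset V, A ⊆ B → B ∈ 𝓘 → A ∈ 𝓘)
    (hexch : ∀ A B : Finset V, A ∈ 𝓘 → B ∈ 𝓘 → A.card < B.card →
      ∃ e ∈ B \ A, insert e A ∈ 𝓘)
    {g : Finset V → ℝ} (hsub : ∀ S T : Finset V, g (S ∩ T) + g (S ∪ T) ≤ g S + g T)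
    {z : EuclideanSpace ℝ V}
    (hz : z ∈ convexHull ℝ (indicatorVec '' (𝓘 : Set (Finset V)))) :
    ∃ S ∈ 𝓘, multilinearExt g z ≤ g S := by
  set K := convexHull ℝ (indicatorVec '' (𝓘 : Set (Finset V))) with hKdef
  have hKc : IsCompact K := (𝓘.finite_toSet.image _).isCompact_convexHull ℝ
  obtain ⟨y₀, hy₀, hmax₀⟩ :=
    hKc.exists_isMaxOn ⟨z, hz⟩ (continuous_multilinearExt g).continuousOn
  have hK₁c : IsCompact (K ∩ {y | multilinearExt g y₀ ≤ multilinearExt g y}) :=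
    hKc.inter_right (isClosed_le continuous_const (continuous_multilinearExt g))
  obtain ⟨y, ⟨hyK, hyF⟩, hnorm⟩ :=
    hK₁c.exists_isMaxOn ⟨y₀, hy₀, le_refl (multilinearExt g y₀)⟩ continuous_norm.continuousOn
  have hmax : ∀ u ∈ K, multilinearExt g u ≤ multilinearExt g y := fun u hu =>
    (hmax₀ hu).trans hyF
  have hnomove : ∀ (v : EuclideanSpace ℝ V) (α m ε : ℝ), v ≠ 0 → 0 < ε → 0 ≤ m →
      (∀ s : ℝ, multilinearExt g (y + s • v) = multilinearExt g y + s * α + s ^ 2 * m) →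
      y + ε • v ∈ K → y + ε • -v ∈ K → False := by
    intro v α m ε hv hε hm hs h1 h2
    rw [smul_neg, ← neg_smul] at h2
    have e1 := hs ε
    have e2 := hs (-ε)
    have l1 := hmax _ h1
    have l2 := hmax _ h2
    have hm' : 0 ≤ ε ^ 2 * m := by positivity
    have k1 : multilinearExt g y ≤ multilinearExt g (y + ε • v) := by nlinarith
    have k2 : multilinearExt g y ≤ multilinearExt g (y + (-ε) • v) := by nlinarith
    have n1 : ‖y + ε • v‖ ≤ ‖y‖ := hnorm ⟨h1, le_trans hyF k1⟩
    have n2 : ‖y + (-ε) • v‖ ≤ ‖y‖ := hnorm ⟨h2, le_trans hyF k2⟩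
    have hpar := parallelogram_law_with_norm ℝ y (ε • v)
    rw [neg_smul, ← sub_eq_add_neg] at n2
    have hpos : 0 < ‖ε • v‖ := norm_pos_iff.2 (smul_ne_zero hε.ne' hv)
    nlinarith [norm_nonneg (y + ε • v), norm_nonneg (y - ε • v)]
  obtain ⟨w, hw0, hw1, hwy⟩ := (mem_convexHull_indicatorVec_iff y).1 hyK
  have hsubset : ∀ A ∈ 𝓘, ∀ B ∈ 𝓘, 0 < w A → 0 < w B → A ⊆ B := by
    intro A hA B hB hwA hwB i hiA
    by_contra hiB
    have hε : 0 < min (w A) (w B) := lt_min hwA hwB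
    rcases exists_double_exchange h𝓘 hdown hexch hA hB hiA hiB with hins | ⟨j, hjB, hjA, hA', hB'⟩
    · refine hnomove (EuclideanSpace.single i 1) (multilinearExt (marginalDiff i g) y) 0 _
        (by simp) hε le_rfl ?_ ?_ ?_
      · intro s
        have : s • EuclideanSpace.single i (1 : ℝ) = EuclideanSpace.single i s := by
          ext k; simp
        rw [this, multilinearExt_add_single]
        ring
      · rw [← indicatorVec_insert_sub hiB, ← hwy]
        exact add_smul_sub_mem_convexHull_indicatorVec hw0 hw1 hB hins hε.le (min_le_right _ _)
      · rw [← indicatorVec_insert_sub (Finset.notMem_erase i A), Finset.insert_erase hiA, neg_sub,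
          ← hwy]
        exact add_smul_sub_mem_convexHull_indicatorVec hw0 hw1 hA
          (hdown _ _ (Finset.erase_subset _ _) hA) hε.le (min_le_left _ _)
    · have hij : i ≠ j := fun h => hjA (h ▸ hiA)
      refine hnomove _ _ _ _ ?_ hε ?_
        (multilinearExt_add_smul_single_sub_single g y i j) ?_ ?_
      · intro h
        have := congrArg (fun v : EuclideanSpace ℝ V => v i) h
        simp [hij] at this
      · rw [neg_nonneg, ← multilinearExt_const 0 y]
        exact multilinearExt_mono (marginalDiff_marginalDiff_nonpos hsub hij)
          (mem_Icc_of_mem_convexHull_indicatorVec hyK)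
      · rw [← indicatorVec_exchange_sub hjB hiB, ← hwy]
        exact add_smul_sub_mem_convexHull_indicatorVec hw0 hw1 hB hB' hε.le (min_le_right _ _)
      · rw [neg_sub, ← indicatorVec_exchange_sub hiA hjA, ← hwy]
        exact add_smul_sub_mem_convexHull_indicatorVec hw0 hw1 hA hA' hε.le (min_le_left _ _)
  obtain ⟨S, hS, hwS⟩ : ∃ S ∈ 𝓘, 0 < w S := by
    by_contra! hcon
    have := Finset.sum_nonpos hcon
    linarith
  have hzero : ∀ R ∈ 𝓘, R ≠ S → w R = 0 := by
    intro R hR hRS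
    by_contra hne
    have hwR := lt_of_le_of_ne (hw0 R hR) (Ne.symm hne)
    exact hRS ((hsubset R hR S hS hwR hwS).antisymm (hsubset S hS R hR hwS hwR))
  have hwS1 : w S = 1 := by
    rw [← hw1, Finset.sum_eq_single_of_mem S hS hzero]
  have hyS : y = indicatorVec S := by
    rw [← hwy, Finset.sum_eq_single_of_mem S hS fun R hR hRS => by rw [hzero R hR hRS, zero_smul],
      hwS1, one_smul]
  refine ⟨S, hS, ?_⟩
  rw [← multilinearExt_indicatorVec g S, ← hyS]
  exact hmax z hz

end MatroidPolytope

lemma extraGradient_step {E : Type*} [NormedAddCommGroup E] [InnerProductSpace ℝ E]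
    {u v u' w p q : E} {γ : ℝ}
    (hv : ⟪(u - γ • p) - v, u' - v⟫ ≤ 0) (hu' : ⟪(u - γ • q) - u', w - u'⟫ ≤ 0) :
    γ * ⟪q, v - w⟫ ≤ ‖u - w‖ ^ 2 / 2 - ‖u' - w‖ ^ 2 / 2 +
      γ ^ 2 * ‖q - p‖ ^ 2 / 2 - ‖u - v‖ ^ 2 / 2 := by
  obtain ⟨a, ha⟩ : ∃ a, a = u - v := ⟨_, rfl⟩
  obtain ⟨b, hb⟩ : ∃ b, b = v - u' := ⟨_, rfl⟩
  obtain ⟨c, hc⟩ : ∃ c, c = u' - w := ⟨_, rfl⟩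
  have e1 : (u - γ • p) - v = a - γ • p := by rw [ha]; abel
  have e2 : u' - v = -b := by rw [hb]; abel
  have e3 : (u - γ • q) - u' = a + b - γ • q := by rw [ha, hb]; abel
  have e4 : w - u' = -c := by rw [hc]; abel
  have e5 : v - w = b + c := by rw [hb, hc]; abel
  have e6 : u - w = a + b + c := by rw [ha, hb, hc]; abel
  rw [e1, e2] at hv
  rw [e3, e4] at hu'
  rw [e5, e6, ← hc, ← ha]
  have young : 0 ≤ ‖γ • (q - p) - b‖ ^ 2 := by positivity
  simp only [← real_inner_self_eq_norm_sq, inner_sub_left, inner_sub_right, inner_add_left,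
    inner_add_right, inner_smul_left, inner_smul_right, inner_neg_right, RCLike.conj_to_real]
    at hv hu' young ⊢
  rw [real_inner_comm a b, real_inner_comm a c, real_inner_comm b c, real_inner_comm p q] at *
  rw [real_inner_comm q b, real_inner_comm p b] at young
  linarith

lemma ConvexOn.sub_le_inner_gradient {E : Type*} [NormedAddCommGroup E] [InnerProductSpace ℝ E]
    [CompleteSpace E] {φ : E → ℝ} (hφ : ConvexOn ℝ Set.univ φ) {x G : E}
    (hG : HasGradientAt φ G x) (w : E) : φ x - φ w ≤ ⟪G, x - w⟫ := by
  have hG' : HasFDerivAt φ (InnerProductSpace.toDual ℝ _ G) x := hG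
  have hline : HasDerivAt (AffineMap.lineMap x w : ℝ → E) (w - x) 0 :=
    AffineMap.hasDerivAt_lineMap
  have h1 := HasFDerivAt.comp_hasDerivAt (x := (0 : ℝ)) (f := (AffineMap.lineMap x w : ℝ → E))
    (by simpa using hG') hline
  have hc : ConvexOn ℝ Set.univ (φ ∘ (AffineMap.lineMap x w : ℝ →ᵃ[ℝ] E)) := by
    simpa using hφ.comp_affineMap (AffineMap.lineMap x w : ℝ →ᵃ[ℝ] E)
  have h2 := hc.le_slope_of_hasDerivAt (Set.mem_univ 0) (Set.mem_univ 1) one_pos h1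
  simp only [InnerProductSpace.toDual_apply_apply, slope_def_field, Function.comp,
    AffineMap.lineMap_apply_one, AffineMap.lineMap_apply_zero, sub_zero, div_one] at h2
  rw [← neg_sub w x, inner_neg_right]
  linarith

lemma convexOn_multilinearExt {E V : Type} [AddCommGroup E] [Module ℝ E] [Fintype V]
    [DecidableEq V] {f : E → Finset V → ℝ}
    (hconv : ∀ S : Finset V, ConvexOn ℝ Set.univ (fun x => f x S))
    {y : EuclideanSpace ℝ V} (hy : ∀ i, 0 ≤ y i ∧ y i ≤ 1) :
    ConvexOn ℝ Set.univ (fun x => multilinearExt (f x) y) := by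
  refine ⟨convex_univ, fun a _ b _ s t hs ht hst => ?_⟩
  simp only [smul_eq_mul]
  rw [← multilinearExt_const_mul, ← multilinearExt_const_mul, ← multilinearExt_add]
  exact multilinearExt_mono (fun R => (hconv R).2 trivial trivial hs ht hst) hy

/-- (Extra-Gradient on the Continuous Extension.) For a
matroid `(V, 𝓘)`, a convex–(monotone submodular) `f ≥ 0` with `f(·,S)` convex
differentiable, multilinear extension `F`, base polytope `K = conv{1_S : S ∈ 𝓘}`,
an `L`-Lipschitz gradient map on `X × K`, step `γ > 0` with `2γL ≤ 1`, and
extra-gradient iterates, the averaged auxiliary iterate `x̄ = (1/T)∑ x̂_t`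
satisfies `(1/2)·max_{S∈𝓘} f(x̄,S) ≤ min_{x∈X} max_{S∈𝓘} f(x,S) + 3H/(2γT)`. -/
theorem extra_gradient_continuous_extension_convergence
    (d : ℕ) (V : Type) [Fintype V] [DecidableEq V]
    (𝓘 : Finset (Finset V)) (h𝓘 : 𝓘.Nonempty)
    (hdown : ∀ A B : Finset V, A ⊆ B → B ∈ 𝓘 → A ∈ 𝓘)
    (hexch : ∀ A B : Finset V, A ∈ 𝓘 → B ∈ 𝓘 → A.card < B.card →
      ∃ e ∈ B \ A, insert e A ∈ 𝓘)
    (f : EuclideanSpace ℝ (Fin d) → Finset V → ℝ)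
    (hf_nonneg : ∀ x S, 0 ≤ f x S)
    (hconv : ∀ S : Finset V, ConvexOn ℝ Set.univ (fun x => f x S))
    (hdiff : ∀ S : Finset V, Differentiable ℝ (fun x => f x S))
    (hmono : ∀ x, ∀ S T : Finset V, S ⊆ T → f x S ≤ f x T)
    (hsub : ∀ x, ∀ S T : Finset V, f x (S ∩ T) + f x (S ∪ T) ≤ f x S + f x T)
    (K : Set (EuclideanSpace ℝ V))
    (hK : K = convexHull ℝ
      {y : EuclideanSpace ℝ V | ∃ S ∈ 𝓘, y = fun i => if i ∈ S then (1 : ℝ) else 0})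
    (X : Set (EuclideanSpace ℝ (Fin d))) (hXne : X.Nonempty)
    (hXcl : IsClosed X) (hXconv : Convex ℝ X)
    (x xhat : ℕ → EuclideanSpace ℝ (Fin d))
    (y yhat : ℕ → EuclideanSpace ℝ V)
    (hx1 : x 1 ∈ X) (hy1 : y 1 ∈ K)
    (H : ℝ) (hH : 0 < H)
    (hboundX : ∀ z ∈ X, ‖z - x 1‖ ^ 2 ≤ H)
    (hboundK : ∀ w ∈ K, ‖w - y 1‖ ^ 2 ≤ H)
    (gx : EuclideanSpace ℝ (Fin d) → EuclideanSpace ℝ V → EuclideanSpace ℝ (Fin d))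
    (gy : EuclideanSpace ℝ (Fin d) → EuclideanSpace ℝ V → EuclideanSpace ℝ V)
    (hgx : ∀ (x' : EuclideanSpace ℝ (Fin d)) (y' : EuclideanSpace ℝ V),
      HasGradientAt (fun z => multilinearExt (f z) y') (gx x' y') x')
    (hgy : ∀ (x' : EuclideanSpace ℝ (Fin d)) (y' : EuclideanSpace ℝ V),
      HasGradientAt (fun w => multilinearExt (f x') w) (gy x' y') y')
    (L : ℝ)
    (hLip : ∀ x' ∈ X, ∀ x'' ∈ X, ∀ y' ∈ K, ∀ y'' ∈ K,
      Real.sqrt (‖gx x'' y'' - gx x' y'‖ ^ 2 + ‖gy x'' y'' - gy x' y'‖ ^ 2) ≤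
        L * Real.sqrt (‖x'' - x'‖ ^ 2 + ‖y'' - y'‖ ^ 2))
    (γ : ℝ) (hγpos : 0 < γ) (hγL : 2 * γ * L ≤ 1)
    (T : ℕ) (hT : 0 < T)
    (hxhat_mem : ∀ t, 1 ≤ t → t ≤ T → xhat t ∈ X)
    (hxhat_proj : ∀ t, 1 ≤ t → t ≤ T → ∀ w ∈ X,
      ⟪(x t - γ • gx (x t) (y t)) - xhat t, w - xhat t⟫ ≤ 0)
    (hyhat_mem : ∀ t, 1 ≤ t → t ≤ T → yhat t ∈ K)
    (hyhat_proj : ∀ t, 1 ≤ t → t ≤ T → ∀ w ∈ K,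
      ⟪(y t + γ • gy (x t) (y t)) - yhat t, w - yhat t⟫ ≤ 0)
    (hx_mem : ∀ t, 1 ≤ t → t ≤ T → x (t + 1) ∈ X)
    (hx_proj : ∀ t, 1 ≤ t → t ≤ T → ∀ w ∈ X,
      ⟪(x t - γ • gx (xhat t) (yhat t)) - x (t + 1), w - x (t + 1)⟫ ≤ 0)
    (hy_mem : ∀ t, 1 ≤ t → t ≤ T → y (t + 1) ∈ K)
    (hy_proj : ∀ t, 1 ≤ t → t ≤ T → ∀ w ∈ K,
      ⟪(y t + γ • gy (xhat t) (yhat t)) - y (t + 1), w - y (t + 1)⟫ ≤ 0)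
    (xbar : EuclideanSpace ℝ (Fin d))
    (hxbar : xbar = (1 / (T : ℝ)) • ∑ t ∈ Finset.Icc 1 T, xhat t) :
    (1 / 2) * 𝓘.sup' h𝓘 (fun S => f xbar S) ≤
      sInf ((fun z => 𝓘.sup' h𝓘 (fun S => f z S)) '' X)
        + 3 * H / (2 * γ * T) := by
  have hK' : K = convexHull ℝ (indicatorVec '' (𝓘 : Set (Finset V))) := by
    rw [hK]
    congr 1
    ext v
    constructor
    · rintro ⟨S, hS, h⟩
      exact ⟨S, hS, WithLp.ofLp_injective 2 h.symm⟩
    · rintro ⟨S, hS, rfl⟩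
      exact ⟨S, hS, rfl⟩
  have hKIcc : ∀ v ∈ K, ∀ i, 0 ≤ v i ∧ v i ≤ 1 := fun v hv =>
    mem_Icc_of_mem_convexHull_indicatorVec (hK' ▸ hv)
  have hxmem : ∀ t, 1 ≤ t → t ≤ T → x t ∈ X := by
    intro t h1 hT'
    obtain rfl | h := h1.eq_or_lt
    · exact hx1
    · obtain ⟨s, rfl⟩ := Nat.exists_eq_add_of_le' h1
      exact hx_mem s (by omega) (by omega)
  have hymem : ∀ t, 1 ≤ t → t ≤ T → y t ∈ K := by
    intro t h1 hT'
    obtain rfl | h := h1.eq_or_lt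
    · exact hy1
    · obtain ⟨s, rfl⟩ := Nat.exists_eq_add_of_le' h1
      exact hy_mem s (by omega) (by omega)
  have hTpos : (0 : ℝ) < T := Nat.cast_pos.2 hT
  rw [← sub_le_iff_le_add]
  refine le_csInf (hXne.image _) ?_
  rintro _ ⟨z, hz, rfl⟩
  obtain ⟨S, hS, hSmax⟩ := 𝓘.exists_mem_eq_sup' h𝓘 (fun S => f xbar S)
  rw [hSmax]
  beta_reduce
  set m := 𝓘.sup' h𝓘 (fun S => f z S) with hm
  have hSK : indicatorVec S ∈ K := by
    rw [hK']
    exact subset_convexHull ℝ _ (Set.mem_image_of_mem _ hS)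
  have hstep : ∀ t, 1 ≤ t → t ≤ T → γ * (f (xhat t) S / 2 - m) ≤
      (‖x t - z‖ ^ 2 / 2 + ‖y t - indicatorVec S‖ ^ 2 / 4) -
        (‖x (t + 1) - z‖ ^ 2 / 2 + ‖y (t + 1) - indicatorVec S‖ ^ 2 / 4) := by
    intro t h1 hT'
    have hyK := hyhat_mem t h1 hT'
    have hconvex : multilinearExt (f (xhat t)) (yhat t) - multilinearExt (f z) (yhat t) ≤
        ⟪gx (xhat t) (yhat t), xhat t - z⟫ :=
      (convexOn_multilinearExt hconv (hKIcc _ hyK)).sub_le_inner_gradient (hgx _ _) z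
    have hdr := sub_two_mul_multilinearExt_le_inner (hf_nonneg (xhat t)) (hmono (xhat t))
      (hsub (xhat t)) (hKIcc _ hyK) (hgy (xhat t) (yhat t)) S
    have hround : multilinearExt (f z) (yhat t) ≤ m := by
      obtain ⟨R, hR, hle⟩ := exists_multilinearExt_le h𝓘 hdown hexch (hsub z) (hK' ▸ hyK)
      exact hle.trans (Finset.le_sup' (fun S => f z S) hR)
    have hsx := extraGradient_step (hxhat_proj t h1 hT' _ (hx_mem t h1 hT'))
      (hx_proj t h1 hT' z hz)
    have hsy := extraGradient_step (u := y t) (v := yhat t) (u' := y (t + 1))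
      (w := indicatorVec S) (p := -gy (x t) (y t)) (q := -gy (xhat t) (yhat t)) (γ := γ)
      (by simpa [sub_neg_eq_add] using hyhat_proj t h1 hT' _ (hy_mem t h1 hT'))
      (by simpa [sub_neg_eq_add] using hy_proj t h1 hT' _ hSK)
    have hnorm : ‖-gy (xhat t) (yhat t) - -gy (x t) (y t)‖ =
        ‖gy (xhat t) (yhat t) - gy (x t) (y t)‖ := by
      rw [neg_sub_neg, norm_sub_rev]
    have hinner : ⟪-gy (xhat t) (yhat t), yhat t - indicatorVec S⟫ =
        ⟪gy (xhat t) (yhat t), indicatorVec S - yhat t⟫ := by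
      rw [inner_neg_left, ← inner_neg_right, neg_sub]
    rw [hnorm, hinner] at hsy
    have hlip := hLip _ (hxmem t h1 hT') _ (hxhat_mem t h1 hT') _ (hymem t h1 hT') _ hyK
    rw [norm_sub_rev (xhat t) (x t), norm_sub_rev (yhat t) (y t)] at hlip
    set A := ‖gx (xhat t) (yhat t) - gx (x t) (y t)‖
    set B := ‖gy (xhat t) (yhat t) - gy (x t) (y t)‖
    set a := ‖x t - xhat t‖
    set b := ‖y t - yhat t‖
    have hsq : 4 * γ ^ 2 * (A ^ 2 + B ^ 2) ≤ a ^ 2 + b ^ 2 := by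
      have hle : 2 * γ * √(A ^ 2 + B ^ 2) ≤ √(a ^ 2 + b ^ 2) := by
        nlinarith [Real.sqrt_nonneg (a ^ 2 + b ^ 2)]
      have hle' := pow_le_pow_left₀ (by positivity) hle 2
      rw [mul_pow, Real.sq_sqrt (by positivity), Real.sq_sqrt (by positivity)] at hle'
      linarith
    have hA : 0 ≤ γ ^ 2 * A ^ 2 := by positivity
    have hB : 0 ≤ γ ^ 2 * B ^ 2 := by positivity
    have ha : 0 ≤ a ^ 2 := by positivity
    have hb : 0 ≤ b ^ 2 := by positivity
    have hlow : γ * (f (xhat t) S / 2 - m) ≤ γ * ⟪gx (xhat t) (yhat t), xhat t - z⟫ +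
        γ * ⟪gy (xhat t) (yhat t), indicatorVec S - yhat t⟫ / 2 := by
      rw [mul_div_assoc, ← mul_add]
      exact mul_le_mul_of_nonneg_left (by linarith) hγpos.le
    linarith
  have htele : ∀ n ≤ T, γ * ∑ t ∈ Finset.Icc 1 n, (f (xhat t) S / 2 - m) ≤
      (‖x 1 - z‖ ^ 2 / 2 + ‖y 1 - indicatorVec S‖ ^ 2 / 4) -
        (‖x (n + 1) - z‖ ^ 2 / 2 + ‖y (n + 1) - indicatorVec S‖ ^ 2 / 4) := by
    intro n
    induction n with
    | zero => simp
    | succ n ih =>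
      intro hn
      rw [Finset.sum_Icc_succ_top (by omega), mul_add]
      linarith [ih (by omega), hstep (n + 1) (by omega) hn]
  have hjensen : T * f xbar S ≤ ∑ t ∈ Finset.Icc 1 T, f (xhat t) S := by
    have h := (hconv S).map_sum_le (t := Finset.Icc 1 T) (w := fun _ => 1 / (T : ℝ)) (p := xhat)
      (fun _ _ => by positivity) (by simp [hTpos.ne']) (fun _ _ => Set.mem_univ _)
    rw [← Finset.smul_sum, ← hxbar, ← Finset.smul_sum, smul_eq_mul, one_div,
      le_inv_mul_iff₀ hTpos] at h
    exact h
  have hfinal := htele T le_rfl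
  rw [Finset.sum_sub_distrib, ← Finset.sum_div] at hfinal
  simp only [Finset.sum_const, Nat.card_Icc, Nat.add_sub_cancel, nsmul_eq_mul] at hfinal
  have hX := hboundX z hz
  have hY := hboundK _ hSK
  rw [norm_sub_rev] at hX hY
  have hkey : γ * (T * (f xbar S / 2 - m)) ≤ 3 * H / 4 := by
    have : γ * (T * (f xbar S / 2 - m)) ≤
        γ * ((∑ t ∈ Finset.Icc 1 T, f (xhat t) S) / 2 - T * m) :=
      mul_le_mul_of_nonneg_left (by linarith) hγpos.le
    have h3 : 0 ≤ ‖x (T + 1) - z‖ ^ 2 := by positivity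
    have h4 : 0 ≤ ‖y (T + 1) - indicatorVec S‖ ^ 2 := by positivity
    linarith
  have hdiv : f xbar S / 2 - m ≤ 3 * H / (2 * γ * T) := by
    rw [le_div_iff₀ (by positivity)]
    linarith
  linarith
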